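/- The λ-open topology τ_λ makes C(X,ℝ^ι) a topological vector space over ℝ (i.e., addition (f,g) ↦ f+g and scalar multiplication (c,f) ↦ c•f are jointly continuous) if and only if every member of λ is C_ι-compact in X and λ = λ(C_ι). -/

import Mathlib

open Topology Set

/-- The λ-open (set-open) topology on `C(X, ι → ℝ)` generated by the subbasis
`[A, U] = {f | f(A) ⊆ U}` for `A ∈ Λ` and `U` open in `ι → ℝ`. -/
def setOpenTopology {X : Type*} [TopologicalSpace X] (ι : Type*) (Λ : Set (Set X)) :
    TopologicalSpace C(X, ι → ℝ) :=
  TopologicalSpace.generateFrom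
    {S | ∃ A ∈ Λ, ∃ U : Set (ι → ℝ), IsOpen U ∧ S = {f : C(X, ι → ℝ) | Set.MapsTo f A U}}

/-- A subset `B ⊆ X` is `C_ι`-compact in `X` if `f(B)` is compact in `ℝ^ι`
for every continuous `f : X → ℝ^ι`. -/
def CCompactIn {X : Type*} [TopologicalSpace X] (ι : Type*) (B : Set X) : Prop :=
  ∀ f : C(X, ι → ℝ), IsCompact (⇑f '' B)

/-- The family `λ(C_ι)`. -/
def lambdaC {X : Type*} [TopologicalSpace X] (ι : Type*) (Λ : Set (Set X)) : Set (Set X) :=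
  {A | A ∈ Λ ∧ ∀ B ⊆ A, CCompactIn ι B → ∀ U : Set (ι → ℝ), IsOpen U →
    IsOpen[setOpenTopology ι Λ] {f : C(X, ι → ℝ) | Set.MapsTo f B U}}

section SetOpen

variable {X ι : Type*} [TopologicalSpace X]

theorem isOpen_setOpenTopology_mapsTo {Λ : Set (Set X)} {A : Set X} (hA : A ∈ Λ)
    {U : Set (ι → ℝ)} (hU : IsOpen U) :
    IsOpen[setOpenTopology ι Λ] {f : C(X, ι → ℝ) | MapsTo f A U} :=
  TopologicalSpace.isOpen_generateFrom_of_mem ⟨A, hA, U, hU, rfl⟩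

theorem continuous_setOpenTopology_iff {Y : Type*} [TopologicalSpace Y] {Λ : Set (Set X)}
    {φ : Y → C(X, ι → ℝ)} :
    Continuous[_, setOpenTopology ι Λ] φ ↔
      ∀ A ∈ Λ, ∀ U : Set (ι → ℝ), IsOpen U → IsOpen {y | MapsTo (φ y) A U} := by
  unfold setOpenTopology
  rw [continuous_generateFrom_iff]
  constructor
  · intro h A hA U hU
    exact h _ ⟨A, hA, U, hU, rfl⟩
  · rintro h _ ⟨A, hA, U, hU, rfl⟩
    exact h A hA U hU

theorem continuous_const_setOpenTopology {Λ : Set (Set X)} (hΛ : ∀ A ∈ Λ, A.Nonempty) :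
    Continuous[_, setOpenTopology ι Λ]
      (fun c : ι → ℝ => (ContinuousMap.const X c : C(X, ι → ℝ))) := by
  rw [continuous_setOpenTopology_iff]
  intro A hA U hU
  obtain ⟨a, ha⟩ := hΛ A hA
  convert hU using 1
  ext c
  exact ⟨fun h => h ha, fun h _ _ => h⟩

theorem CCompactIn.isCompact_image_real [Nonempty ι] {A : Set X} (hA : CCompactIn ι A)
    (φ : C(X, ℝ)) : IsCompact (φ '' A) := by
  obtain ⟨i⟩ := ‹Nonempty ι›
  have h := (hA ⟨fun x _ => φ x, by fun_prop⟩).image (continuous_apply i)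
  rwa [image_image] at h

theorem CCompactIn.isCompact_image_proper [Nonempty ι] {Y : Type*} [MetricSpace Y] [ProperSpace Y]
    {A : Set X} (hA : CCompactIn ι A) (f : C(X, Y)) : IsCompact (f '' A) := by
  rcases A.eq_empty_or_nonempty with rfl | ⟨a, ha⟩
  · simp
  have key (p : Y) : IsCompact ((fun x => dist (f x) p) '' A) :=
    hA.isCompact_image_real ⟨fun x => dist (f x) p, by fun_prop⟩
  refine Metric.isCompact_of_isClosed_isBounded (isClosed_of_closure_subset fun p hp => ?_) ?_
  · have h0 : (0 : ℝ) ∈ (fun x => dist (f x) p) '' A := by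
      rw [← (key p).isClosed.closure_eq, Metric.mem_closure_iff]
      intro ε hε
      obtain ⟨_, ⟨x, hx, rfl⟩, hxp⟩ := Metric.mem_closure_iff.1 hp ε hε
      refine ⟨_, ⟨x, hx, rfl⟩, ?_⟩
      simpa [Real.dist_eq, abs_of_nonneg, dist_comm] using hxp
    obtain ⟨x, hx, hxp⟩ := h0
    exact ⟨x, hx, dist_eq_zero.1 hxp⟩
  · obtain ⟨r, hr⟩ := (key (f a)).bddAbove
    refine (Metric.isBounded_iff_subset_closedBall (f a)).2 ⟨r, ?_⟩
    rintro _ ⟨x, hx, rfl⟩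
    exact hr ⟨x, hx, rfl⟩

theorem CCompactIn.isCompact_image_prodMk [Nonempty ι] {A : Set X} (hA : CCompactIn ι A)
    (φ : C(X, ℝ)) (h : C(X, ι → ℝ)) : IsCompact ((fun x => (φ x, h x)) '' A) := by
  cases finite_or_infinite ι
  · have := Fintype.ofFinite ι
    exact hA.isCompact_image_proper (φ.prodMk h)
  · obtain ⟨e⟩ : Nonempty (Option ι ≃ ι) := by
      rw [← Cardinal.eq, Cardinal.mk_option]
      exact Cardinal.add_one_eq (Cardinal.aleph0_le_mk ι)
    let g : C(X, ι → ℝ) := ⟨fun x j => (e.symm j).elim (φ x) (h x), by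
      refine continuous_pi fun j => ?_
      cases e.symm j with
      | none => exact φ.continuous
      | some i => exact (continuous_apply i).comp h.continuous⟩
    have hc : Continuous fun y : ι → ℝ => (y (e none), fun i => y (e (some i))) := by fun_prop
    have := (hA g).image hc
    rw [image_image] at this
    simpa [g] using this

theorem CCompactIn.inter_preimage [Nonempty ι] {A : Set X} (hA : CCompactIn ι A)
    (φ : C(X, ℝ)) {C : Set ℝ} (hC : IsClosed C) : CCompactIn ι (A ∩ φ ⁻¹' C) := by
  intro h
  convert ((hA.isCompact_image_prodMk φ h).inter_right (hC.preimage continuous_fst)).image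
    continuous_snd using 1
  ext y
  constructor
  · rintro ⟨x, ⟨hxA, hxC⟩, rfl⟩
    exact ⟨_, ⟨⟨x, hxA, rfl⟩, hxC⟩, rfl⟩
  · rintro ⟨_, ⟨⟨x, hxA, rfl⟩, hxC⟩, rfl⟩
    exact ⟨x, ⟨hxA, hxC⟩, rfl⟩

theorem setOf_mapsTo_sub_mem_nhds [Nonempty ι] {Λ : Set (Set X)} {A : Set X} (hc : CCompactIn ι A)
    (hA : A ∈ lambdaC ι Λ) (f : C(X, ι → ℝ)) {V : Set (ι → ℝ)} (hV : V ∈ 𝓝 0) :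
    {g : C(X, ι → ℝ) | MapsTo (g - f) A V} ∈ @nhds _ (setOpenTopology ι Λ) f := by
  let _ : TopologicalSpace C(X, ι → ℝ) := setOpenTopology ι Λ
  rw [nhds_pi, Filter.mem_pi] at hV
  obtain ⟨I, hI, t, ht, htV⟩ := hV
  suffices h : ∀ i ∈ I, {g : C(X, ι → ℝ) | ∀ x ∈ A, g x i - f x i ∈ t i} ∈ 𝓝 f by
    filter_upwards [(Filter.biInter_mem hI).2 h] with g hg x hx
    refine htV fun i hi => ?_
    exact mem_iInter₂.1 hg i hi x hx
  intro i _
  obtain ⟨ε, hε, hεt⟩ := Metric.mem_nhds_iff.1 (ht i)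
  let φ : C(X, ℝ) := ⟨fun x => f x i, by fun_prop⟩
  obtain ⟨s, -, hs, hcov⟩ :=
    (hc.isCompact_image_real φ).finite_cover_balls (e := ε / 4) (by positivity)
  have hs' : ∀ c ∈ s, {g : C(X, ι → ℝ) | MapsTo g (A ∩ φ ⁻¹' Metric.closedBall c (ε / 4))
      {y | y i ∈ Metric.ball c (ε / 2)}} ∈ 𝓝 f := by
    intro c _
    refine (hA.2 _ inter_subset_left (hc.inter_preimage φ Metric.isClosed_closedBall) _
      (Metric.isOpen_ball.preimage (continuous_apply i))).mem_nhds ?_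
    exact fun x hx => Metric.closedBall_subset_ball (by linarith) hx.2
  filter_upwards [(Filter.biInter_mem hs).2 hs'] with g hg x hx
  obtain ⟨c, hcs, hxc⟩ := mem_iUnion₂.1 (hcov ⟨x, hx, rfl⟩)
  have h1 : dist (g x i) c < ε / 2 :=
    mem_iInter₂.1 hg c hcs ⟨hx, Metric.ball_subset_closedBall hxc⟩
  have h2 : dist (f x i) c < ε / 4 := hxc
  apply hεt
  have h3 := dist_triangle_right (g x i) (f x i) c
  change dist (g x i - f x i) 0 < ε
  rw [dist_zero_right, ← dist_eq_norm]
  linarith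

theorem isOpen_setOf_mapsTo_of_forall_mem_nhds {Y : Type*} [TopologicalSpace Y] {A : Set X}
    {φ : Y → C(X, ι → ℝ)} (hA : CCompactIn ι A)
    (h : ∀ y, ∀ V ∈ 𝓝 (0 : ι → ℝ), ∀ᶠ z in 𝓝 y, MapsTo (φ z - φ y) A V)
    {U : Set (ι → ℝ)} (hU : IsOpen U) : IsOpen {y | MapsTo (φ y) A U} := by
  rw [isOpen_iff_mem_nhds]
  intro y hy
  obtain ⟨V, hV, hVU⟩ :=
    compact_open_separated_add_right (hA (φ y)) hU (mapsTo_iff_image_subset.1 hy)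
  filter_upwards [h y V hV] with z hz x hx
  have := hVU (add_mem_add (mem_image_of_mem _ hx) (hz hx))
  simpa using this

theorem continuous_add_setOpenTopology [Nonempty ι] {Λ : Set (Set X)}
    (hc : ∀ A ∈ Λ, CCompactIn ι A) (hΛ : Λ ⊆ lambdaC ι Λ) :
    Continuous[@instTopologicalSpaceProd _ _ (setOpenTopology ι Λ) (setOpenTopology ι Λ),
      setOpenTopology ι Λ] (fun p : C(X, ι → ℝ) × C(X, ι → ℝ) => p.1 + p.2) := by
  let _ : TopologicalSpace C(X, ι → ℝ) := setOpenTopology ι Λ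
  refine continuous_setOpenTopology_iff.2 fun A hA U hU =>
    isOpen_setOf_mapsTo_of_forall_mem_nhds (hc A hA) ?_ hU
  rintro ⟨f, g⟩ V hV
  obtain ⟨W, hW, hWV⟩ := exists_nhds_zero_half hV
  have h (k : C(X, ι → ℝ)) := setOf_mapsTo_sub_mem_nhds (hc A hA) (hΛ hA) k hW
  filter_upwards [prod_mem_nhds (h f) (h g)] with p hp x hx
  have := hWV _ (hp.1 hx) _ (hp.2 hx)
  convert this using 1
  change p.1 x + p.2 x - (f x + g x) = (p.1 x - f x) + (p.2 x - g x)
  abel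

theorem continuous_smul_setOpenTopology [Nonempty ι] {Λ : Set (Set X)}
    (hc : ∀ A ∈ Λ, CCompactIn ι A) (hΛ : Λ ⊆ lambdaC ι Λ) :
    Continuous[@instTopologicalSpaceProd _ _ inferInstance (setOpenTopology ι Λ),
      setOpenTopology ι Λ] (fun p : ℝ × C(X, ι → ℝ) => p.1 • p.2) := by
  let _ : TopologicalSpace C(X, ι → ℝ) := setOpenTopology ι Λ
  refine continuous_setOpenTopology_iff.2 fun A hA U hU =>
    isOpen_setOf_mapsTo_of_forall_mem_nhds (hc A hA) ?_ hU
  rintro ⟨c, f⟩ V hV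
  obtain ⟨W, hW, hWV⟩ := exists_nhds_zero_half hV
  have hcW : ∀ᶠ q : ℝ × (ι → ℝ) in 𝓝 c ×ˢ 𝓝 0, q.1 • q.2 ∈ W := by
    rw [← nhds_prod_eq]
    have : Continuous fun q : ℝ × (ι → ℝ) => q.1 • q.2 := by fun_prop
    exact this.tendsto (c, 0) (by simpa using hW)
  obtain ⟨P, hP, Q, hQ, hPQ⟩ := Filter.eventually_prod_iff.1 hcW
  have hfW : ∀ᶠ d in 𝓝 c, ∀ y ∈ f '' A, (d - c) • y ∈ W := by
    refine (hc A hA f).eventually_forall_of_forall_eventually fun y _ => ?_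
    have : Continuous fun q : ℝ × (ι → ℝ) => (q.1 - c) • q.2 := by fun_prop
    exact this.tendsto (c, y) (by simpa using hW)
  have h := setOf_mapsTo_sub_mem_nhds (hc A hA) (hΛ hA) f hQ
  filter_upwards [prod_mem_nhds (hP.and hfW) h] with p hp x hx
  have := hWV _ (hPQ hp.1.1 (hp.2 hx)) _ (hp.1.2 _ (mem_image_of_mem f hx))
  convert this using 1
  change p.1 • p.2 x - c • f x = p.1 • (p.2 x - f x) + (p.1 - c) • f x
  module

theorem cCompactIn_of_continuous_add_smul {Λ : Set (Set X)} (hΛ : ∀ A ∈ Λ, A.Nonempty)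
    (hadd : Continuous[@instTopologicalSpaceProd _ _ (setOpenTopology ι Λ) (setOpenTopology ι Λ),
      setOpenTopology ι Λ] (fun p : C(X, ι → ℝ) × C(X, ι → ℝ) => p.1 + p.2))
    (hsmul : Continuous[@instTopologicalSpaceProd _ _ inferInstance (setOpenTopology ι Λ),
      setOpenTopology ι Λ] (fun p : ℝ × C(X, ι → ℝ) => p.1 • p.2))
    {A : Set X} (hA : A ∈ Λ) : CCompactIn ι A := by
  let _ : TopologicalSpace C(X, ι → ℝ) := setOpenTopology ι Λ
  intro f
  have hbdd (i : ι) : ∃ r : ℝ, ∀ x ∈ A, f x i ∈ Icc (-r) r := by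
    have hcont : Continuous fun t : ℝ => t • f := hsmul.comp (Continuous.prodMk_left f)
    have hopen : IsOpen {y : ι → ℝ | |y i| < 1} := isOpen_lt (by fun_prop) continuous_const
    have h0 : ∀ᶠ t : ℝ in 𝓝 0, MapsTo (t • f) A {y : ι → ℝ | |y i| < 1} :=
      ((isOpen_setOpenTopology_mapsTo hA hopen).preimage hcont).mem_nhds fun x _ => by simp
    obtain ⟨t, ht, ht0⟩ :=
      ((h0.filter_mono nhdsWithin_le_nhds).and (self_mem_nhdsWithin (s := Ioi (0 : ℝ)))).exists
    refine ⟨t⁻¹, fun x hx => abs_le.1 ?_⟩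
    have h1 : |t * f x i| < 1 := ht hx
    rw [abs_mul, abs_of_pos ht0] at h1
    rw [← one_div, le_div_iff₀' ht0]
    exact h1.le
  choose r hr using hbdd
  refine (isCompact_univ_pi fun i => isCompact_Icc (a := -r i) (b := r i)).of_isClosed_subset
    (isClosed_of_closure_subset fun p hp => ?_) ?_
  · by_contra hpA
    have hcont : Continuous fun c : ι → ℝ => f + ContinuousMap.const X c :=
      hadd.comp ((continuous_const (y := f)).prodMk (continuous_const_setOpenTopology hΛ))
    have h0 : ∀ᶠ c : ι → ℝ in 𝓝 0, MapsTo (f + ContinuousMap.const X c) A {p}ᶜ :=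
      ((isOpen_setOpenTopology_mapsTo hA isOpen_compl_singleton).preimage hcont).mem_nhds
        fun x hx hxp => hpA ⟨x, hx, by simpa using hxp⟩
    have hsub : Filter.Tendsto (fun y : ι → ℝ => p - y) (𝓝 p) (𝓝 0) := by
      have : Continuous fun y : ι → ℝ => p - y := by fun_prop
      simpa using this.tendsto p
    obtain ⟨_, ⟨x, hx, rfl⟩, hy⟩ := ((mem_closure_iff_frequently.1 hp).and_eventually
      (hsub.eventually h0)).exists
    exact hy hx (by simp)
  · rintro _ ⟨x, hx, rfl⟩ i _
    exact hr i x hx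

theorem isOpen_setOf_mapsTo_of_continuous_add {Λ : Set (Set X)}
    (hadd : Continuous[@instTopologicalSpaceProd _ _ (setOpenTopology ι Λ) (setOpenTopology ι Λ),
      setOpenTopology ι Λ] (fun p : C(X, ι → ℝ) × C(X, ι → ℝ) => p.1 + p.2))
    {A B : Set X} (hA : A ∈ Λ) (hBA : B ⊆ A) (hB : CCompactIn ι B)
    {U : Set (ι → ℝ)} (hU : IsOpen U) :
    IsOpen[setOpenTopology ι Λ] {f : C(X, ι → ℝ) | MapsTo f B U} := by
  let _ : TopologicalSpace C(X, ι → ℝ) := setOpenTopology ι Λ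
  refine isOpen_setOf_mapsTo_of_forall_mem_nhds (φ := id) hB (fun f V hV => ?_) hU
  obtain ⟨W, hWV, hW, h0W⟩ := mem_nhds_iff.1 hV
  have hcont : Continuous fun g : C(X, ι → ℝ) => g + -f := hadd.comp (Continuous.prodMk_left (-f))
  filter_upwards [((isOpen_setOpenTopology_mapsTo hA hW).preimage hcont).mem_nhds
    (x := f) fun x _ => by simpa using h0W] with g hg x hx
  have := hWV (hg (hBA hx))
  simpa [sub_eq_add_neg] using this

end SetOpen

theorem statement_4 {X : Type*} [TopologicalSpace X] [T35Space X]
    (ι : Type*) [Nonempty ι] (Λ : Set (Set X)) (hΛ : ∀ A ∈ Λ, A.Nonempty) :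
    (Continuous[@instTopologicalSpaceProd _ _ (setOpenTopology ι Λ) (setOpenTopology ι Λ),
        setOpenTopology ι Λ]
        (fun p : C(X, ι → ℝ) × C(X, ι → ℝ) => p.1 + p.2) ∧
      Continuous[@instTopologicalSpaceProd _ _ inferInstance (setOpenTopology ι Λ),
        setOpenTopology ι Λ]
        (fun p : ℝ × C(X, ι → ℝ) => p.1 • p.2)) ↔
    (∀ A ∈ Λ, CCompactIn ι A) ∧ Λ = lambdaC ι Λ := by
  constructor
  · rintro ⟨hadd, hsmul⟩
    refine ⟨fun A hA => cCompactIn_of_continuous_add_smul hΛ hadd hsmul hA,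
      Subset.antisymm (fun A hA => ⟨hA, fun B hBA hB U hU => ?_⟩) fun A hA => hA.1⟩
    exact isOpen_setOf_mapsTo_of_continuous_add hadd hA hBA hB hU
  · rintro ⟨hc, hΛC⟩
    exact ⟨continuous_add_setOpenTopology hc hΛC.subset,
      continuous_smul_setOpenTopology hc hΛC.subset⟩
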